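/- arXiv:1606.08961 — 2 statements merged into one kernel-verified Lean document; each statement's English description precedes it below -/
import Mathlib

section
/- Let (c_{jk})_{j,k∈ℤ} be a bounded family of complex numbers. Then: (a) for every (x,y) ∈ ℝ² the double series φ(x,y) := Σ_{j∈ℤ} Σ_{k∈ℤ} c_{jk} η(x − 2πj) η(y − 2πk) converges absolutely; (b) |φ(x,y)| ≤ sup_{j,k}|c_{jk}| for all (x,y) ∈ ℝ²; (c) φ(2πj, 2πk) = c_{jk} for all integers j, k; and (d) φ extends to an entire function Φ on ℂ² (given by the same series, which converges locally uniformly on ℂ²) satisfying |Φ(z,w)| ≤ (sup_{j,k}|c_{jk}|) · e^{|Im z| + |Im w|} for all (z,w) ∈ ℂ²; in particular φ ∈ E^∞_1(ℝ²). -/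
noncomputable def eta (z : ℂ) : ℂ :=
  if z = 0 then 1 else 2 * (1 - Complex.cos z) / z ^ 2

def ExpClass2 (σ : ℝ) (φ : ℝ → ℝ → ℂ) : Prop :=
  Continuous (fun p : ℝ × ℝ => φ p.1 p.2) ∧ (∃ M : ℝ, ∀ x y, ‖φ x y‖ ≤ M) ∧
  ∃ F : ℂ × ℂ → ℂ, Differentiable ℂ F ∧
    (∀ x y : ℝ, F ((x : ℂ), (y : ℂ)) = φ x y) ∧
    ∃ c : ℝ, ∀ z : ℂ × ℂ, ‖F z‖ ≤ c * Real.exp (σ * (|z.1.im| + |z.2.im|))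

open Complex hiding eta
open Metric

/-- `eta ζ` is the square of the Fourier transform of the indicator function of `[-1/2, 1/2]`. -/
lemma integral_cexp_sq_eq_eta (ζ : ℂ) :
    (∫ t in (-1 / 2 : ℝ)..(1 / 2), cexp (I * ζ * t)) ^ 2 = eta ζ := by
  unfold eta
  split_ifs with h
  · simp [h]; norm_num
  · have hI : I * ζ ≠ 0 := mul_ne_zero I_ne_zero h
    rw [integral_exp_mul_complex hI, div_pow, Complex.cos]
    have h1 : cexp (I * ζ * ((1 / 2 : ℝ) : ℂ)) * cexp (I * ζ * ((-1 / 2 : ℝ) : ℂ)) = 1 := by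
      rw [← Complex.exp_add, Complex.exp_eq_one_iff]
      exact ⟨0, by push_cast; ring⟩
    have h2 : cexp (ζ * I) = cexp (I * ζ * ((1 / 2 : ℝ) : ℂ)) ^ 2 := by
      rw [← Complex.exp_nat_mul]; congr 1; push_cast; ring
    have h3 : cexp (-ζ * I) = cexp (I * ζ * ((-1 / 2 : ℝ) : ℂ)) ^ 2 := by
      rw [← Complex.exp_nat_mul]; congr 1; push_cast; ring
    rw [h2, h3, mul_pow, I_sq]
    generalize cexp (I * ζ * ((1 / 2 : ℝ) : ℂ)) = a at h1
    generalize cexp (I * ζ * ((-1 / 2 : ℝ) : ℂ)) = b at h1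
    field_simp
    linear_combination 2 * h1

lemma differentiable_eta : Differentiable ℂ eta := by
  have hd : Differentiable ℂ (dslope Complex.sin 0) := by
    rw [← differentiableOn_univ, Complex.differentiableOn_dslope Filter.univ_mem]
    exact Complex.differentiable_sin.differentiableOn
  have heq : eta = fun z => dslope Complex.sin 0 (z / 2) ^ 2 := by
    funext z
    unfold eta
    split_ifs with h
    · simp [h]
    · have h' : z / 2 ≠ 0 := by simpa using h
      rw [dslope_of_ne _ h', slope_def_field, Complex.sin_zero, sub_zero, sub_zero]
      have hc : Complex.cos z = 1 - 2 * Complex.sin (z / 2) ^ 2 := by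
        have := Complex.cos_two_mul (z / 2)
        rw [mul_div_cancel₀ z two_ne_zero] at this
        linear_combination this + 2 * Complex.sin_sq_add_cos_sq (z / 2)
      rw [hc]
      field_simp
      ring
  rw [heq]
  exact (hd.comp (differentiable_id.div_const 2)).pow 2

/-- Parseval's identity for the exponential `t ↦ exp (i z t)` on `[-1/2, 1/2]`. -/
lemma hasSum_norm_eta (z : ℂ) :
    HasSum (fun j : ℤ => ‖eta (z - 2 * Real.pi * j)‖)
      (∫ t in (-1 / 2 : ℝ)..(1 / 2), Real.exp (-2 * z.im * t)) := by
  have hab : (-1 / 2 : ℝ) < 1 / 2 := by norm_num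
  have hc : Continuous (fun t : ℝ => cexp (I * z * t)) := by fun_prop
  have hL2 : MeasureTheory.MemLp (fun t : ℝ => cexp (I * z * t)) 2
      (MeasureTheory.volume.restrict (Set.Ioc (-1 / 2 : ℝ) (1 / 2))) := by
    obtain ⟨C, hC⟩ := isCompact_Icc.exists_bound_of_continuousOn hc.continuousOn
    exact .of_bound hc.aestronglyMeasurable C (MeasureTheory.ae_restrict_of_forall_mem
      measurableSet_Ioc fun t ht => hC t (Set.Ioc_subset_Icc_self ht))
  convert hasSum_sq_fourierCoeffOn hab hL2 using 1
  · funext j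
    rw [fourierCoeffOn_eq_integral, ← norm_pow, ← integral_cexp_sq_eq_eta]
    have hT : (1 / 2 - -1 / 2 : ℝ) = 1 := by norm_num
    simp only [hT, div_one, one_smul, fourier_coe_apply, smul_eq_mul]
    congr 3
    funext t
    rw [← Complex.exp_add]
    congr 1
    push_cast
    ring
  · have hT : (1 / 2 - -1 / 2 : ℝ)⁻¹ = 1 := by norm_num
    rw [hT, one_smul]
    congr 1
    funext t
    rw [Complex.norm_exp, ← Real.exp_nat_mul]
    congr 1
    simp
    ring

lemma tsum_norm_eta_le (z : ℂ) :
    ∑' j : ℤ, ‖eta (z - 2 * Real.pi * j)‖ ≤ Real.exp |z.im| := by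
  rw [(hasSum_norm_eta z).tsum_eq]
  have h : ∀ t ∈ Set.uIoc (-1 / 2 : ℝ) (1 / 2),
      ‖Real.exp (-2 * z.im * t)‖ ≤ Real.exp |z.im| := by
    intro t ht
    rw [Set.uIoc_of_le (by norm_num)] at ht
    rw [Real.norm_eq_abs, Real.abs_exp, Real.exp_le_exp]
    have ht' : |t| ≤ 1 / 2 := abs_le.2 ⟨by linarith [ht.1], ht.2⟩
    calc -2 * z.im * t ≤ |-2 * z.im * t| := le_abs_self _
      _ = 2 * |z.im| * |t| := by rw [abs_mul, abs_mul]; norm_num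
      _ ≤ 2 * |z.im| * (1 / 2) := by gcongr
      _ = |z.im| := by ring
  refine (Real.le_norm_self _).trans
    ((intervalIntegral.norm_integral_le_of_norm_le_const h).trans_eq ?_)
  norm_num

lemma norm_eta_le (z : ℂ) : ‖eta z‖ ≤ Real.exp |z.im| := by
  have h := (hasSum_norm_eta z).summable.le_tsum 0 fun _ _ => norm_nonneg _
  simpa using h.trans (tsum_norm_eta_le z)

lemma norm_cos_le_exp_abs_im (z : ℂ) : ‖Complex.cos z‖ ≤ Real.exp |z.im| := by
  have h1 : ‖cexp (z * I)‖ ≤ Real.exp |z.im| := by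
    rw [Complex.norm_exp, Real.exp_le_exp]
    simpa using neg_le_abs z.im
  have h2 : ‖cexp (-z * I)‖ ≤ Real.exp |z.im| := by
    rw [Complex.norm_exp, Real.exp_le_exp]
    simpa using le_abs_self z.im
  rw [Complex.cos, norm_div, Complex.norm_two]
  linarith [norm_add_le (cexp (z * I)) (cexp (-z * I))]

lemma norm_eta_mul_sq_le (z : ℂ) : ‖eta z‖ * ‖z‖ ^ 2 ≤ 4 * Real.exp |z.im| := by
  by_cases h : z = 0
  · simp [h]
  have he : eta z * z ^ 2 = 2 * (1 - Complex.cos z) := by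
    rw [eta, if_neg h]
    field_simp
  rw [← norm_pow, ← norm_mul, he, norm_mul, Complex.norm_two]
  have h1 := norm_sub_le (1 : ℂ) (Complex.cos z)
  rw [norm_one] at h1
  linarith [norm_cos_le_exp_abs_im z, Real.one_le_exp (abs_nonneg z.im)]

lemma norm_eta_sub_le {R : ℝ} {z : ℂ} (hz : ‖z‖ ≤ R) (j : ℤ) :
    ‖eta (z - 2 * Real.pi * j)‖ ≤ 5 * Real.exp R * (2 + 2 * R ^ 2) * (1 / (1 + (j : ℝ) ^ 2)) := by
  set ζ : ℂ := z - 2 * Real.pi * j with hζ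
  have hR : 0 ≤ R := (norm_nonneg z).trans hz
  have him : |ζ.im| ≤ R := by
    have : ζ.im = z.im := by simp [hζ]
    rw [this]
    exact (Complex.abs_im_le_norm z).trans hz
  have hη : ‖eta ζ‖ * (1 + ‖ζ‖ ^ 2) ≤ 5 * Real.exp R := by
    linarith [norm_eta_le ζ, norm_eta_mul_sq_le ζ, Real.exp_le_exp.2 him]
  have hj : |(j : ℝ)| ≤ ‖ζ‖ + R := by
    have h1 : ‖(2 * Real.pi * j : ℂ)‖ = 2 * Real.pi * |(j : ℝ)| := by
      simp [abs_of_pos Real.pi_pos]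
    have h2 : ‖(2 * Real.pi * j : ℂ)‖ ≤ ‖ζ‖ + R := by
      have : (2 * Real.pi * j : ℂ) = z - ζ := by rw [hζ]; ring
      rw [this]
      linarith [norm_sub_le z ζ]
    nlinarith [Real.pi_gt_three, abs_nonneg (j : ℝ)]
  have hj2 : 1 + (j : ℝ) ^ 2 ≤ (2 + 2 * R ^ 2) * (1 + ‖ζ‖ ^ 2) := by
    have : (j : ℝ) ^ 2 ≤ (‖ζ‖ + R) ^ 2 := by
      rw [← sq_abs (j : ℝ)]
      gcongr
    nlinarith [sq_nonneg (‖ζ‖ - R), sq_nonneg (R * ‖ζ‖)]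
  rw [mul_one_div, le_div_iff₀ (by positivity)]
  calc ‖eta ζ‖ * (1 + (j : ℝ) ^ 2) ≤ ‖eta ζ‖ * ((2 + 2 * R ^ 2) * (1 + ‖ζ‖ ^ 2)) := by gcongr
    _ = ‖eta ζ‖ * (1 + ‖ζ‖ ^ 2) * (2 + 2 * R ^ 2) := by ring
    _ ≤ 5 * Real.exp R * (2 + 2 * R ^ 2) := by gcongr

lemma summable_one_div_one_add_int_sq : Summable fun j : ℤ => 1 / (1 + (j : ℝ) ^ 2) := by
  refine .of_norm_bounded_eventually
    ((Real.summable_one_div_int_pow (p := 2)).2 one_lt_two) ?_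
  rw [Filter.eventually_cofinite]
  refine (Set.finite_singleton (0 : ℤ)).subset fun j hj => ?_
  by_contra h0
  have h0' : (j : ℝ) ≠ 0 := by exact_mod_cast h0
  have hpos : 0 < (j : ℝ) ^ 2 := by positivity
  refine hj ?_
  rw [Real.norm_of_nonneg (by positivity)]
  exact one_div_le_one_div_of_le hpos (by linarith)

lemma eta_two_pi_mul_int {n : ℤ} (hn : n ≠ 0) : eta (2 * Real.pi * n) = 0 := by
  have h : (2 * Real.pi * n : ℂ) ≠ 0 := by
    simp [hn, Real.pi_ne_zero]
  have hc : Complex.cos (2 * Real.pi * n) = 1 := by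
    rw [mul_comm]
    exact Complex.cos_int_mul_two_pi n
  rw [eta, if_neg h, hc]
  simp

/-- A series of entire functions on a complex normed space which is dominated on every ball by
a summable family has an entire sum. -/
lemma differentiable_tsum_of_norm_le_on_balls {ι E : Type*} [NormedAddCommGroup E]
    [NormedSpace ℂ E] {f : ι → E → ℂ} (hf : ∀ i, Differentiable ℂ (f i))
    (hb : ∀ R : ℝ, ∃ u : ι → ℝ, Summable u ∧ ∀ i z, ‖z‖ ≤ R → ‖f i z‖ ≤ u i) :
    Differentiable ℂ fun z => ∑' i, f i z := by
  intro q
  let : NormedSpace ℝ E := NormedSpace.restrictScalars ℝ ℂ E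
  obtain ⟨u, hu, hfu⟩ := hb (‖q‖ + 2)
  have hq : q ∈ ball (0 : E) (‖q‖ + 1) := by simp
  refine (hasFDerivAt_tsum_of_isPreconnected (u := fun i => 2 * u i)
    (f' := fun i z => fderiv ℂ (f i) z) (hu.mul_left 2) isOpen_ball
    (convex_ball (0 : E) (‖q‖ + 1)).isPreconnected (fun i z _ => (hf i z).hasFDerivAt)
    (fun i z hz => ?_) hq ?_ hq).differentiableAt
  · have hz' : ‖z‖ < ‖q‖ + 1 := by simpa using hz
    have hmaps : Set.MapsTo (f i) (ball z 1) (closedBall (f i z) (2 * u i)) := by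
      intro w hw
      have hw' : ‖w - z‖ < 1 := by simpa [dist_eq_norm] using hw
      have h1 := hfu i w (by linarith [norm_sub_norm_le w z])
      have h2 := hfu i z (by linarith)
      rw [mem_closedBall, dist_eq_norm]
      linarith [norm_sub_le (f i w) (f i z)]
    simpa using Complex.norm_fderiv_le_div_of_mapsTo_ball (hf i).differentiableOn hmaps one_pos
  · exact .of_norm_bounded hu fun i => hfu i q (by linarith)

/-- Interpolation: from a bounded family `(c_{jk})` one builds
`φ(x,y) = Σ_{j,k} c_{jk} η(x − 2πj) η(y − 2πk)`, which converges absolutely, is bounded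
by `sup |c_{jk}|`, interpolates `c_{jk}` at the points `(2πj, 2πk)`, and extends to an
entire function on `ℂ²` of exponential type `1` in each variable; in particular
`φ ∈ E^∞_1(ℝ²)`. -/
theorem interpolation_function_properties (c : ℤ → ℤ → ℂ)
    (hbdd : ∃ M : ℝ, ∀ j k : ℤ, ‖c j k‖ ≤ M) :
    (∀ x y : ℝ, Summable (fun p : ℤ × ℤ =>
        ‖c p.1 p.2 * eta ((x : ℂ) - 2 * Real.pi * p.1) * eta ((y : ℂ) - 2 * Real.pi * p.2)‖)) ∧
    (∀ x y : ℝ,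
        ‖∑' p : ℤ × ℤ, c p.1 p.2 * eta ((x : ℂ) - 2 * Real.pi * p.1) *
            eta ((y : ℂ) - 2 * Real.pi * p.2)‖ ≤ ⨆ p : ℤ × ℤ, ‖c p.1 p.2‖) ∧
    (∀ j k : ℤ,
        (∑' p : ℤ × ℤ, c p.1 p.2 * eta ((2 * Real.pi * j : ℝ) - 2 * Real.pi * p.1 : ℂ) *
            eta ((2 * Real.pi * k : ℝ) - 2 * Real.pi * p.2 : ℂ)) = c j k) ∧
    (∃ Φ : ℂ × ℂ → ℂ, Differentiable ℂ Φ ∧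
      (∀ z w : ℂ,
        Summable (fun p : ℤ × ℤ =>
          c p.1 p.2 * eta (z - 2 * Real.pi * p.1) * eta (w - 2 * Real.pi * p.2)) ∧
        Φ (z, w) = ∑' p : ℤ × ℤ,
          c p.1 p.2 * eta (z - 2 * Real.pi * p.1) * eta (w - 2 * Real.pi * p.2)) ∧
      (∀ z w : ℂ, ‖Φ (z, w)‖ ≤
          (⨆ p : ℤ × ℤ, ‖c p.1 p.2‖) * Real.exp (|z.im| + |w.im|))) ∧
    ExpClass2 1 (fun x y : ℝ => ∑' p : ℤ × ℤ,
      c p.1 p.2 * eta ((x : ℂ) - 2 * Real.pi * p.1) * eta ((y : ℂ) - 2 * Real.pi * p.2)) := by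
  set S : ℝ := ⨆ p : ℤ × ℤ, ‖c p.1 p.2‖
  have hcS : ∀ p : ℤ × ℤ, ‖c p.1 p.2‖ ≤ S := by
    obtain ⟨M, hM⟩ := hbdd
    exact le_ciSup ⟨M, by rintro _ ⟨p, rfl⟩; exact hM p.1 p.2⟩
  have hS0 : 0 ≤ S := (norm_nonneg _).trans (hcS 0)
  set T : ℤ × ℤ → ℂ × ℂ → ℂ := fun p z =>
    c p.1 p.2 * eta (z.1 - 2 * Real.pi * p.1) * eta (z.2 - 2 * Real.pi * p.2) with hT
  have hTle : ∀ p z, ‖T p z‖ ≤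
      S * (‖eta (z.1 - 2 * Real.pi * p.1)‖ * ‖eta (z.2 - 2 * Real.pi * p.2)‖) := by
    intro p z
    rw [hT, norm_mul, norm_mul, mul_assoc]
    gcongr
    exact hcS p
  have hprod : ∀ z w : ℂ, HasSum (fun p : ℤ × ℤ =>
      S * (‖eta (z - 2 * Real.pi * p.1)‖ * ‖eta (w - 2 * Real.pi * p.2)‖))
      (S * ((∑' j : ℤ, ‖eta (z - 2 * Real.pi * j)‖) *
        ∑' k : ℤ, ‖eta (w - 2 * Real.pi * k)‖)) := by
    intro z w
    have hz := (hasSum_norm_eta z).summable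
    have hw := (hasSum_norm_eta w).summable
    exact (hz.hasSum.mul hw.hasSum
      (hz.mul_of_nonneg hw (fun _ => norm_nonneg _) fun _ => norm_nonneg _)).mul_left S
  have hsum : ∀ z, Summable fun p => ‖T p z‖ := fun z =>
    .of_nonneg_of_le (fun _ => norm_nonneg _) (fun p => hTle p z) (hprod z.1 z.2).summable
  have hbound : ∀ z, ‖∑' p, T p z‖ ≤ S * Real.exp (|z.1.im| + |z.2.im|) := by
    intro z
    refine (tsum_of_norm_bounded (hprod z.1 z.2) fun p => hTle p z).trans ?_
    rw [Real.exp_add]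
    gcongr
    · exact tsum_norm_eta_le z.1
    · exact tsum_norm_eta_le z.2
  have hdiff : Differentiable ℂ fun z => ∑' p, T p z := by
    refine differentiable_tsum_of_norm_le_on_balls (fun p => ?_) fun R => ?_
    · exact ((differentiable_eta.comp (differentiable_fst.sub (differentiable_const _))).const_mul _).mul
        (differentiable_eta.comp (differentiable_snd.sub (differentiable_const _)))
    · have hs := summable_one_div_one_add_int_sq.mul_left
        (5 * Real.exp R * (2 + 2 * R ^ 2))
      refine ⟨_, (hs.mul_of_nonneg hs (fun _ => by positivity)
        fun _ => by positivity).mul_left S, fun p z hz => (hTle p z).trans ?_⟩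
      gcongr
      · exact norm_eta_sub_le ((norm_fst_le z).trans hz) p.1
      · exact norm_eta_sub_le ((norm_snd_le z).trans hz) p.2
  have hreal : ∀ x y : ℝ, ‖∑' p, T p ((x : ℂ), (y : ℂ))‖ ≤ S := fun x y => by
    simpa using hbound ((x : ℂ), (y : ℂ))
  refine ⟨fun x y => hsum (x, y), hreal, fun j k => ?_,
    ⟨fun z => ∑' p, T p z, hdiff, fun z w => ⟨(hsum (z, w)).of_norm, rfl⟩,
      fun z w => hbound (z, w)⟩,
    hdiff.continuous.comp (by fun_prop : Continuous fun p : ℝ × ℝ => ((p.1 : ℂ), (p.2 : ℂ))),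
    ⟨S, hreal⟩, fun z => ∑' p, T p z, hdiff, fun _ _ => rfl, S, fun z => ?_⟩
  · have hshift : ∀ m n : ℤ, ((2 * Real.pi * m : ℝ) - 2 * Real.pi * n : ℂ) =
        2 * Real.pi * (m - n : ℤ) := fun m n => by push_cast; ring
    simp only [hshift]
    rw [tsum_eq_single (j, k)]
    · simp [eta]
    · rintro ⟨m, n⟩ hmn
      by_cases hm : j - m = 0
      · have hn : k - n ≠ 0 := fun hn => hmn (by
          rw [sub_eq_zero.1 hm, sub_eq_zero.1 hn])
        simp only [eta_two_pi_mul_int hn, mul_zero]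
      · simp only [eta_two_pi_mul_int hm, mul_zero, zero_mul]
  · simpa using hbound z
end

section
/- Let d ≥ 1 and 1 ≤ j ≤ d. Let (h_m)_{m≥1} be a sequence of bounded continuous functions on ℝᵈ such that each h_m is the restriction to ℝᵈ of an entire function H_m : ℂᵈ → ℂ satisfying |H_m(z)| ≤ (sup_{x∈ℝᵈ}|h_m(x)|) · exp(2^{-m+1}(|Im z₁| + … + |Im z_d|)) for all z ∈ ℂᵈ, and suppose Σ_{m≥1} 2^{-m} · sup_{x∈ℝᵈ}|h_m(x)| < ∞. Then each h_m is differentiable on ℝᵈ and the series Σ_{m≥1} ∂h_m/∂x_j converges uniformly on ℝᵈ. -/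
/-- The real-linear embedding `ℝᵈ → ℂᵈ`. -/
noncomputable def ofRealPi (ι : Type*) : (ι → ℝ) →L[ℝ] (ι → ℂ) :=
  ContinuousLinearMap.pi fun i => Complex.ofRealCLM.comp (ContinuousLinearMap.proj i)

theorem ofRealPi_apply {ι : Type*} (x : ι → ℝ) : ofRealPi ι x = fun i => (x i : ℂ) := rfl

theorem ofRealPi_single {ι : Type*} [DecidableEq ι] (j : ι) :
    ofRealPi ι (Pi.single j 1) = Pi.single j 1 := by
  ext i
  by_cases hij : i = j
  · subst hij; simp [ofRealPi_apply]
  · simp [ofRealPi_apply, hij]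

/-- Bernstein-type inequality (with the non-sharp constant `e`) for the partial derivatives at
real points of an entire function of exponential type `σ` on `ℂᵈ`. -/
theorem norm_fderiv_single_le_of_exponential_type {ι : Type*} [Fintype ι] [DecidableEq ι]
    {H : (ι → ℂ) → ℂ} (hH : Differentiable ℂ H) {M σ : ℝ} (hM : 0 ≤ M) (hσ : 0 < σ)
    (hbound : ∀ z, ‖H z‖ ≤ M * Real.exp (σ * ∑ i, |(z i).im|)) (x : ι → ℝ) (j : ι) :
    ‖fderiv ℂ H (ofRealPi ι x) (Pi.single j 1)‖ ≤ M * Real.exp 1 * σ := by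
  set line : ℂ → ι → ℂ := fun w => ofRealPi ι x + w • Pi.single j 1 with hline
  have hline_deriv : HasDerivAt line (Pi.single j 1) 0 := by
    simpa [hline] using (hasDerivAt_id (0 : ℂ)).smul_const (Pi.single j 1 : ι → ℂ)
  have hline_diff : Differentiable ℂ line := by fun_prop
  have hderiv : deriv (H ∘ line) 0 = fderiv ℂ H (ofRealPi ι x) (Pi.single j 1) := by
    have h0 : line 0 = ofRealPi ι x := by simp [hline]
    rw [← h0]
    exact ((hH _).hasFDerivAt.comp_hasDerivAt 0 hline_deriv).deriv
  have hsphere : ∀ w ∈ Metric.sphere (0 : ℂ) σ⁻¹, ‖(H ∘ line) w‖ ≤ M * Real.exp 1 := by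
    intro w hw
    have hw' : ‖w‖ = σ⁻¹ := by simpa using hw
    refine (hbound (line w)).trans ?_
    have him : ∑ i, |(line w i).im| = |w.im| := by
      rw [Finset.sum_eq_single j]
      · simp [hline, ofRealPi_apply]
      · intro i _ hij
        simp [hline, ofRealPi_apply, hij]
      · simp
    have hle : σ * |w.im| ≤ 1 := by
      calc σ * |w.im| ≤ σ * σ⁻¹ := by
            gcongr
            exact hw' ▸ Complex.abs_im_le_norm w
        _ = 1 := mul_inv_cancel₀ hσ.ne'
    rw [him]
    gcongr
  have := Complex.norm_deriv_le_of_forall_mem_sphere_norm_le (inv_pos.2 hσ)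
    (hH.comp hline_diff).diffContOnCl hsphere
  rwa [hderiv, div_inv_eq_mul] at this

/-- If `(h_m)_{m≥1}` are bounded continuous functions on `ℝᵈ`, each the restriction of an
entire function of exponential type `2^{-m+1}` bounded by its sup-norm times the
exponential factor, and `Σ_m 2^{-m} ‖h_m‖_∞ < ∞`, then each `h_m` is differentiable and
the series of partial derivatives `Σ_m ∂h_m/∂x_j` converges uniformly on `ℝᵈ`. -/
theorem besov_pieces_derivative_series_converges_uniformly
    (d : ℕ) (hd : 1 ≤ d) (j : Fin d) (h : ℕ → (Fin d → ℝ) → ℂ)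
    (hcont : ∀ m, 1 ≤ m → Continuous (h m))
    (hbdd : ∀ m, 1 ≤ m → ∃ M : ℝ, ∀ x, ‖h m x‖ ≤ M)
    (hext : ∀ m, 1 ≤ m → ∃ H : (Fin d → ℂ) → ℂ, Differentiable ℂ H ∧
      (∀ x : Fin d → ℝ, H (fun i => (x i : ℂ)) = h m x) ∧
      ∀ z : Fin d → ℂ, ‖H z‖ ≤ (⨆ x : Fin d → ℝ, ‖h m x‖) *
        Real.exp ((2 : ℝ) ^ (-(m : ℝ) + 1) * ∑ i, |(z i).im|))
    (hsum : Summable fun m : ℕ =>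
      (2 : ℝ) ^ (-((m : ℝ) + 1)) * ⨆ x : Fin d → ℝ, ‖h (m + 1) x‖) :
    (∀ m, 1 ≤ m → Differentiable ℝ (h m)) ∧
    ∃ S : (Fin d → ℝ) → ℂ,
      TendstoUniformly
        (fun N : ℕ => fun x : Fin d → ℝ =>
          ∑ m ∈ Finset.Icc 1 N, fderiv ℝ (h m) x (Pi.single j 1))
        S Filter.atTop := by
  have hfderiv : ∀ m, 1 ≤ m → Differentiable ℝ (h m) ∧ ∀ x,
      ‖fderiv ℝ (h m) x (Pi.single j 1)‖ ≤
        (⨆ x : Fin d → ℝ, ‖h m x‖) * Real.exp 1 * (2 : ℝ) ^ (-(m : ℝ) + 1) := by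
    intro m hm
    obtain ⟨H, hH, hrestr, hbound⟩ := hext m hm
    have hd' : ∀ x, HasFDerivAt (h m)
        (((fderiv ℂ H (ofRealPi (Fin d) x)).restrictScalars ℝ).comp (ofRealPi (Fin d))) x := by
      intro x
      have heq : h m = H ∘ ofRealPi (Fin d) := funext fun y => (hrestr y).symm
      rw [heq]
      exact ((hH _).hasFDerivAt.restrictScalars ℝ).comp x (ofRealPi (Fin d)).hasFDerivAt
    refine ⟨fun x => (hd' x).differentiableAt, fun x => ?_⟩
    rw [(hd' x).fderiv]
    simpa [ofRealPi_single] using norm_fderiv_single_le_of_exponential_type hH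
      (Real.iSup_nonneg fun x => norm_nonneg (h m x)) (by positivity) hbound x j
  refine ⟨fun m hm => (hfderiv m hm).1,
    fun x => ∑' m : ℕ, fderiv ℝ (h (m + 1)) x (Pi.single j 1), ?_⟩
  have hunif := tendstoUniformly_tsum_nat (hsum.mul_left (2 * Real.exp 1))
    (f := fun (m : ℕ) (x : Fin d → ℝ) => fderiv ℝ (h (m + 1)) x (Pi.single j 1))
    (fun m x => ((hfderiv (m + 1) (Nat.le_add_left 1 m)).2 x).trans_eq (by
      rw [Real.rpow_add_one two_ne_zero]
      push_cast
      ring))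
  convert hunif using 3 with N x
  rw [Finset.range_eq_Ico]
  rw [Finset.sum_Ico_add' (fun m => fderiv ℝ (h m) x (Pi.single j 1)) 0 N 1]
  rfl
end
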